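/- arXiv:1501.04668 — 5 statements merged into one kernel-verified Lean document; each statement's English description precedes it below -/
import Mathlib

section
/- Let K = u/v be shift-reduced with K ≠ 1, and let a, b, p ∈ F[y] with b nonzero, shift-free, and strongly prime with K. If a/b + p/v belongs to V_K, then b divides a (equivalently, a/b is a polynomial). -/
open Polynomial

noncomputable def pshift (F : Type*) [Field F] (i : ℤ) :
    Polynomial F →ₐ[F] Polynomial F :=
  aeval (X + C (i : F))

noncomputable def rshift (F : Type*) [Field F] (i : ℤ) : RatFunc F → RatFunc F :=
  fun f => RatFunc.mk (pshift F i f.num) (pshift F i f.denom)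

def shiftFree {F : Type*} [Field F] (p : Polynomial F) : Prop :=
  p ≠ 0 ∧ ∀ i : ℤ, i ≠ 0 → IsCoprime p (pshift F i p)

def shiftReducedPair {F : Type*} [Field F] (u v : Polynomial F) : Prop :=
  u ≠ 0 ∧ v ≠ 0 ∧ IsCoprime u v ∧ ∀ i : ℤ, IsCoprime u (pshift F i v)

def stronglyPrime {F : Type*} [Field F] (p u v : Polynomial F) : Prop :=
  p ≠ 0 ∧ ∀ i : ℕ, IsCoprime p (pshift F (-(i : ℤ)) u) ∧ IsCoprime p (pshift F (i : ℤ) v)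

noncomputable def phiK {F : Type*} [Field F] (u v : Polynomial F) :
    Polynomial F → Polynomial F :=
  fun p => u * pshift F 1 p - v * p

noncomputable def WK (F : Type*) [Field F] (u v : Polynomial F) :
    Submodule F (Polynomial F) :=
  Submodule.span F {q : Polynomial F | ∃ ℓ : ℕ, q = X ^ ℓ ∧
    ∀ w : Polynomial F, w ∈ Set.range (phiK u v) → w ≠ 0 → ℓ ≠ w.natDegree}

def VK {F : Type*} [Field F] (K : RatFunc F) : Set (RatFunc F) :=
  {g | ∃ r : RatFunc F, g = K * rshift F 1 r - r}

def residualForm {F : Type*} [Field F] (u v : Polynomial F) (r : RatFunc F) : Prop :=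
  ∃ a b q : Polynomial F, a.degree < b.degree ∧ shiftFree b ∧ stronglyPrime b u v ∧
    q ∈ WK F u v ∧ r = RatFunc.mk a b + RatFunc.mk q v

lemma aeval_pshift {F A : Type*} [Field F] [CommRing A] [Algebra F A] (i : ℤ) (x : A)
    (p : Polynomial F) : aeval x (pshift F i p) = aeval (x + i) p := by
  rw [pshift, ← AlgHom.comp_apply]
  congr 1
  ext
  simp

lemma aeval_ne_zero_of_isCoprime {F A : Type*} [Field F] [Field A] [Algebra F A]
    {p q : Polynomial F} (h : IsCoprime p q) {x : A} (hp : aeval x p = 0) : aeval x q ≠ 0 := by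
  obtain ⟨c, d, h⟩ := h
  intro hq
  simpa [hp, hq] using congrArg (aeval x) h

lemma eq_zero_of_aeval_injective {F A : Type*} [Field F] [Field A] [Algebra F A]
    {p : Polynomial F} {f : ℕ → A} (hf : f.Injective) (h : ∀ n, aeval (f n) p = 0) : p = 0 := by
  by_contra hp
  refine Set.infinite_range_of_injective hf ((p.rootSet_finite A).subset ?_)
  rintro _ ⟨n, rfl⟩
  exact (mem_rootSet_of_ne hp).2 (h n)

lemma pshift_ne_zero {F : Type*} [Field F] (i : ℤ) {p : Polynomial F} (hp : p ≠ 0) :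
    pshift F i p ≠ 0 := by
  have h : pshift F i p = p.comp (X + C (i : F)) := rfl
  rwa [h, Ne, comp_X_add_C_eq_zero_iff]

lemma exists_isCoprime_of_mem_VK {F : Type*} [Field F] {u v a b p : Polynomial F}
    (hv : v ≠ 0) (hb : b ≠ 0)
    (h : RatFunc.mk a b + RatFunc.mk p v ∈ VK (RatFunc.mk u v)) :
    ∃ s t : Polynomial F, t ≠ 0 ∧ IsCoprime s t ∧
      (v * a + p * b) * (t * pshift F 1 t) =
        b * (u * pshift F 1 s * t - v * s * pshift F 1 t) := by
  obtain ⟨r, h⟩ := h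
  refine ⟨r.num, r.denom, r.denom_ne_zero, r.isCoprime_num_denom, ?_⟩
  have hinj := RatFunc.algebraMap_injective F
  have h0 : ∀ {q : Polynomial F}, q ≠ 0 → algebraMap F[X] (RatFunc F) q ≠ 0 := fun hq =>
    (map_ne_zero_iff _ hinj).2 hq
  have hv' := h0 hv
  have hb' := h0 hb
  have ht' := h0 r.denom_ne_zero
  have hs' := h0 (pshift_ne_zero 1 r.denom_ne_zero)
  apply hinj
  rw [rshift] at h
  nth_rw 3 [← RatFunc.num_div_denom r] at h
  simp only [RatFunc.mk_eq_div] at h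
  field_simp at h
  simp only [map_mul, map_add, map_sub]
  linear_combination h

lemma false_of_shift_eq_at_root {F A : Type*} [Field F] [Field A] [CharZero A] [Algebra F A]
    {u v a b p s t : Polynomial F} (ht : t ≠ 0) (hst : IsCoprime s t)
    (h : (v * a + p * b) * (t * pshift F 1 t) =
      b * (u * pshift F 1 s * t - v * s * pshift F 1 t))
    {x : A} (hx : aeval x b = 0) (hax : aeval x a ≠ 0)
    (hb_ne : ∀ i : ℤ, i ≠ 0 → aeval (x + i) b ≠ 0)
    (hu_ne : ∀ i : ℕ, aeval (x - i) u ≠ 0) (hv_ne : ∀ i : ℕ, aeval (x + i) v ≠ 0) :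
    False := by
  have heq (y : A) : (aeval y v * aeval y a + aeval y p * aeval y b) *
      (aeval y t * aeval (y + 1) t) = aeval y b * (aeval y u * aeval (y + 1) s * aeval y t -
        aeval y v * aeval y s * aeval (y + 1) t) := by
    simpa [aeval_pshift] using congrArg (aeval y) h
  have hs_ne (y : A) (hy : aeval y t = 0) : aeval y s ≠ 0 :=
    aeval_ne_zero_of_isCoprime hst.symm hy
  have hstart : aeval x t = 0 ∨ aeval (x + 1) t = 0 := by
    have hv0 : aeval x v ≠ 0 := by simpa using hv_ne 0
    simpa [hx, hv0, hax] using heq x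
  rcases hstart with h0 | h1
  · refine ht (eq_zero_of_aeval_injective (A := A) (f := fun n : ℕ => x - n) ?_ ?_)
    · intro m n hmn
      simpa using hmn
    · intro n
      induction n with
      | zero => simpa using h0
      | succ n ih =>
        have hy : x - ((n + 1 : ℕ) : A) + 1 = x - n := by push_cast; ring
        have hbn : aeval (x - ((n + 1 : ℕ) : A)) b ≠ 0 := by
          simpa [sub_eq_add_neg] using hb_ne (-((n + 1 : ℕ) : ℤ)) (by omega)
        have := heq (x - ((n + 1 : ℕ) : A))
        rw [hy, ih] at this
        simpa only [mul_zero, sub_zero, zero_eq_mul, mul_eq_zero, hbn, hu_ne, hs_ne _ ih, false_or] using this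
  · refine ht (eq_zero_of_aeval_injective (A := A) (f := fun n : ℕ => x + (n + 1 : ℕ)) ?_ ?_)
    · intro m n hmn
      simpa using hmn
    · intro n
      induction n with
      | zero => simpa using h1
      | succ n ih =>
        have hy : x + ((n + 1 : ℕ) : A) + 1 = x + ((n + 1 + 1 : ℕ) : A) := by push_cast; ring
        have hbn : aeval (x + ((n + 1 : ℕ) : A)) b ≠ 0 := by
          simpa using hb_ne ((n + 1 : ℕ) : ℤ) (by omega)
        have := heq (x + ((n + 1 : ℕ) : A))
        rw [hy, ih] at this
        simpa only [mul_zero, zero_mul, zero_sub, mul_neg, zero_eq_neg, mul_eq_zero, hbn, hv_ne,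
          hs_ne _ ih, false_or] using this

lemma exists_eq_mul_isCoprime {F : Type*} [Field F] (a b : Polynomial F) :
    ∃ g a' b' : Polynomial F, IsCoprime a' b' ∧ a = g * a' ∧ b = g * b' := by
  classical
  let := EuclideanDomain.gcdMonoid F[X]
  obtain ⟨a', b', ha, hb, h⟩ := extract_gcd a b
  exact ⟨_, a', b', (gcd_isUnit_iff a' b').1 h, ha, hb⟩

/-- If a/b + p/v belongs to V_K, then b divides a. -/
theorem stmt1 {F : Type*} [Field F] [CharZero F] (u v a b p : Polynomial F)
    (hsr : shiftReducedPair u v) (hK1 : RatFunc.mk u v ≠ 1)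
    (hb : shiftFree b) (hbsp : stronglyPrime b u v)
    (h : RatFunc.mk a b + RatFunc.mk p v ∈ VK (RatFunc.mk u v)) :
    b ∣ a := by
  obtain ⟨s, t, ht, hst, h⟩ := exists_isCoprime_of_mem_VK hsr.2.1 hb.1 h
  obtain ⟨hb0, hb⟩ := hb
  replace hbsp := hbsp.2
  obtain ⟨g, a', b', hcop, ha', hb'⟩ := exists_eq_mul_isCoprime a b
  have hg : g ≠ 0 := by rintro rfl; simp [hb'] at hb0
  by_cases hunit : IsUnit b'
  · rw [ha', hb']
    exact mul_dvd_mul_left g hunit.dvd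
  exfalso
  have : CharZero (AlgebraicClosure F) :=
    charZero_of_injective_algebraMap (algebraMap F (AlgebraicClosure F)).injective
  have hb'0 : b' ≠ 0 := by rintro rfl; simp [hb'] at hb0
  obtain ⟨x, hx⟩ := IsAlgClosed.exists_aeval_eq_zero (AlgebraicClosure F) b'
    (fun h' => hunit (isUnit_iff_degree_eq_zero.2 h'))
  have hbx : aeval x b = 0 := by simp [hb', hx]
  have hax : aeval x a' ≠ 0 := aeval_ne_zero_of_isCoprime hcop.symm hx
  have hb_ne (i : ℤ) (hi : i ≠ 0) : aeval (x + i) b' ≠ 0 := by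
    have := aeval_ne_zero_of_isCoprime (hb i hi) hbx
    rw [aeval_pshift, hb', map_mul] at this
    exact right_ne_zero_of_mul this
  have hu_ne (i : ℕ) : aeval (x - i) u ≠ 0 := by
    have := aeval_ne_zero_of_isCoprime (hbsp i).1 hbx
    rwa [aeval_pshift, Int.cast_neg, Int.cast_natCast, ← sub_eq_add_neg] at this
  have hv_ne (i : ℕ) : aeval (x + i) v ≠ 0 := by
    have := aeval_ne_zero_of_isCoprime (hbsp i).2 hbx
    rwa [aeval_pshift, Int.cast_natCast] at this
  have h' : (v * a' + p * b') * (t * pshift F 1 t) =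
      b' * (u * pshift F 1 s * t - v * s * pshift F 1 t) := by
    apply mul_left_cancel₀ hg
    rw [ha', hb'] at h
    linear_combination h
  exact false_of_shift_eq_at_root ht hst h' hx hax hb_ne hu_ne hv_ne
end

section
/- Let K = u/v be shift-reduced with K ≠ 1, and let p ∈ F[y]. Then there exists q ∈ W_K such that p − q/v belongs to V_K. -/
open Polynomial

/-- The map `p ↦ u * σ p - v * p` as a linear map. -/
noncomputable def phiKLinear {F : Type*} [Field F] (u v : Polynomial F) :
    Polynomial F →ₗ[F] Polynomial F :=
  (LinearMap.mulLeft F u).comp (pshift F 1).toLinearMap - LinearMap.mulLeft F v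

theorem phiKLinear_apply {F : Type*} [Field F] (u v p : Polynomial F) :
    phiKLinear u v p = phiK u v p := rfl

/-- A subspace of `F[X]` containing a monic polynomial of every degree is everything. -/
theorem Submodule.eq_top_of_exists_monic {F : Type*} [Field F] (T : Submodule F F[X])
    (h : ∀ n : ℕ, ∃ g ∈ T, g.Monic ∧ g.natDegree = n) : T = ⊤ := by
  have key : ∀ (n : ℕ) (f : F[X]), f.degree < n → f ∈ T := by
    intro n
    induction n with
    | zero =>
      intro f hf
      have : f = 0 := by
        rw [← degree_eq_bot]
        simpa using hf
      simp [this]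
    | succ n ih =>
      intro f hf
      obtain ⟨g, hgT, hg, rfl⟩ := h n
      have hlt : (f - f.coeff g.natDegree • g).degree < g.natDegree := by
        rw [degree_lt_iff_coeff_zero] at hf ⊢
        intro m hm
        rcases hm.eq_or_lt with rfl | hm
        · simp [hg.coeff_natDegree]
        · simp [hf m hm, coeff_eq_zero_of_natDegree_lt hm]
      have := T.add_mem (ih _ hlt) (T.smul_mem (f.coeff g.natDegree) hgT)
      rwa [sub_add_cancel] at this
  refine eq_top_iff.2 fun f _ => key (f.natDegree + 1) f ?_
  exact degree_le_natDegree.trans_lt (by exact_mod_cast Nat.lt_succ_self _)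

theorem WK_sup_range_phiKLinear {F : Type*} [Field F] (u v : Polynomial F) :
    WK F u v ⊔ LinearMap.range (phiKLinear u v) = ⊤ := by
  refine Submodule.eq_top_of_exists_monic _ fun n => ?_
  by_cases h : ∃ w ∈ Set.range (phiK u v), w ≠ 0 ∧ n = w.natDegree
  · obtain ⟨_, ⟨p, rfl⟩, hw, rfl⟩ := h
    have hc : (phiK u v p).leadingCoeff⁻¹ ≠ 0 := inv_ne_zero (leadingCoeff_ne_zero.2 hw)
    refine ⟨(phiK u v p).leadingCoeff⁻¹ • phiK u v p,
      Submodule.mem_sup_right (Submodule.smul_mem _ _ ⟨p, rfl⟩), ?_, ?_⟩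
    · rw [Monic, smul_eq_C_mul, leadingCoeff_mul, leadingCoeff_C,
        inv_mul_cancel₀ (leadingCoeff_ne_zero.2 hw)]
    · rw [smul_eq_C_mul, natDegree_C_mul hc]
  · push Not at h
    exact ⟨X ^ n, Submodule.mem_sup_left (Submodule.subset_span ⟨n, rfl, h⟩),
      monic_X_pow n, natDegree_X_pow n⟩

theorem rshift_algebraMap {F : Type*} [Field F] (i : ℤ) (p : Polynomial F) :
    rshift F i (algebraMap F[X] (RatFunc F) p) =
      algebraMap F[X] (RatFunc F) (pshift F i p) := by
  simp [rshift, RatFunc.num_algebraMap, RatFunc.denom_algebraMap]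

/-- For every p ∈ F[y] there is q ∈ W_K with p − q/v ∈ V_K. -/
theorem stmt5 {F : Type*} [Field F] [CharZero F] (u v p : Polynomial F)
    (hsr : shiftReducedPair u v) (hK1 : RatFunc.mk u v ≠ 1) :
    ∃ q ∈ WK F u v,
      algebraMap (Polynomial F) (RatFunc F) p - RatFunc.mk q v ∈ VK (RatFunc.mk u v) := by
  obtain ⟨_, hv, -, -⟩ := hsr
  have hmem : v * p ∈ WK F u v ⊔ LinearMap.range (phiKLinear u v) := by
    rw [WK_sup_range_phiKLinear]
    exact Submodule.mem_top
  obtain ⟨q, hq, _, ⟨w, rfl⟩, hsum⟩ := Submodule.mem_sup.1 hmem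
  refine ⟨q, hq, algebraMap F[X] (RatFunc F) w, ?_⟩
  have hv' : algebraMap F[X] (RatFunc F) v ≠ 0 := RatFunc.algebraMap_ne_zero hv
  have h := congrArg (algebraMap F[X] (RatFunc F)) hsum
  rw [phiKLinear_apply, phiK] at h
  simp only [map_add, map_sub, map_mul] at h
  rw [rshift_algebraMap, RatFunc.mk_eq_div, RatFunc.mk_eq_div]
  field_simp
  linear_combination -h
end

section
/- Let K = u/v be shift-reduced with K ≠ 1, and set α₁ = deg(u), β = deg(v − u). If β ≥ α₁, then deg(φ_K(p)) = β + deg(p) for every nonzero p ∈ F[y], W_K is the F-linear span of {1, y, …, y^{β−1}}, and dim_F(W_K) = β. -/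
open Polynomial

section Shift

variable {F : Type*} [Field F] {u v p : F[X]}

theorem pshift_eq_comp (i : ℤ) (p : F[X]) : pshift F i p = p.comp (X + C (i : F)) := rfl

theorem degree_pshift_sub_lt (i : ℤ) (hp : p ≠ 0) : (pshift F i p - p).degree < p.degree := by
  have hd : (pshift F i p).natDegree = p.natDegree := by
    simp only [pshift_eq_comp, natDegree_comp, natDegree_X_add_C, mul_one]
  have hlc : (pshift F i p).leadingCoeff = p.leadingCoeff := by
    rw [pshift_eq_comp, leadingCoeff_comp (by rw [natDegree_X_add_C]; exact one_ne_zero),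
      leadingCoeff_X_add_C, one_pow, mul_one]
  have h0 : pshift F i p ≠ 0 := by
    rwa [← leadingCoeff_ne_zero, hlc, leadingCoeff_ne_zero]
  have hdeg : (pshift F i p).degree = p.degree := by
    rw [degree_eq_natDegree h0, degree_eq_natDegree hp, hd]
  exact hdeg ▸ degree_sub_lt_left hdeg h0 hlc

theorem degree_phiK (huv : v - u ≠ 0) (hcase : u.natDegree ≤ (v - u).natDegree) (hp : p ≠ 0) :
    (phiK u v p).degree = (v - u).degree + p.degree := by
  have hlt : (u * (pshift F 1 p - p)).degree < ((v - u) * p).degree := by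
    rw [degree_mul, degree_mul]
    have hu : u.degree ≤ (v - u).degree :=
      degree_le_natDegree.trans (by rw [degree_eq_natDegree huv]; exact_mod_cast hcase)
    calc u.degree + (pshift F 1 p - p).degree
        ≤ (v - u).degree + (pshift F 1 p - p).degree := by gcongr
      _ < (v - u).degree + p.degree :=
        WithBot.add_lt_add_left (degree_ne_bot.mpr huv) (degree_pshift_sub_lt 1 hp)
  have hphi : phiK u v p = u * (pshift F 1 p - p) - (v - u) * p := by
    simp only [phiK]; ring
  rw [hphi, degree_sub_eq_right_of_degree_lt hlt, degree_mul]

theorem natDegree_phiK (huv : v - u ≠ 0) (hcase : u.natDegree ≤ (v - u).natDegree) (hp : p ≠ 0) :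
    (phiK u v p).natDegree = (v - u).natDegree + p.natDegree := by
  apply natDegree_eq_of_degree_eq_some
  rw [degree_phiK huv hcase hp, degree_eq_natDegree huv, degree_eq_natDegree hp, Nat.cast_add]

theorem phiK_ne_zero (huv : v - u ≠ 0) (hcase : u.natDegree ≤ (v - u).natDegree) (hp : p ≠ 0) :
    phiK u v p ≠ 0 := by
  rw [← degree_ne_bot, degree_phiK huv hcase hp, ← degree_mul, degree_ne_bot]
  exact mul_ne_zero huv hp

theorem forall_ne_natDegree_phiK_iff (huv : v - u ≠ 0) (hcase : u.natDegree ≤ (v - u).natDegree)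
    (ℓ : ℕ) :
    (∀ w : F[X], w ∈ Set.range (phiK u v) → w ≠ 0 → ℓ ≠ w.natDegree) ↔
      ℓ < (v - u).natDegree := by
  constructor
  · intro h
    by_contra! hle
    have hX : (X ^ (ℓ - (v - u).natDegree) : F[X]) ≠ 0 := pow_ne_zero _ X_ne_zero
    refine h _ ⟨_, rfl⟩ (phiK_ne_zero huv hcase hX) ?_
    rw [natDegree_phiK huv hcase hX, natDegree_X_pow]
    omega
  · rintro h _ ⟨p, rfl⟩ hw
    have hp : p ≠ 0 := by
      rintro rfl
      simp [phiK] at hw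
    rw [natDegree_phiK huv hcase hp]
    omega

theorem span_X_pow_lt_eq_degreeLT (n : ℕ) :
    Submodule.span F {q : F[X] | ∃ ℓ : ℕ, ℓ < n ∧ q = X ^ ℓ} = degreeLT F n := by
  classical
  rw [degreeLT_eq_span_X_pow]
  congr 1
  ext q
  simp [eq_comm]

theorem finrank_degreeLT (n : ℕ) : Module.finrank F (degreeLT F n) = n := by
  rw [(degreeLTEquiv F n).finrank_eq, Module.finrank_fin_fun]

end Shift

/-- Case β ≥ α₁: degrees of φ_K-images, echelon description of W_K, and its
dimension. -/
theorem stmt7 {F : Type*} [Field F] [CharZero F] (u v : Polynomial F)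
    (hsr : shiftReducedPair u v) (hK1 : RatFunc.mk u v ≠ 1)
    (hcase : u.natDegree ≤ (v - u).natDegree) :
    (∀ p : Polynomial F, p ≠ 0 →
        (phiK u v p).natDegree = (v - u).natDegree + p.natDegree) ∧
    WK F u v = Submodule.span F
      {q : Polynomial F | ∃ ℓ : ℕ, ℓ < (v - u).natDegree ∧ q = X ^ ℓ} ∧
    Module.finrank F (WK F u v) = (v - u).natDegree := by
  have huv : v - u ≠ 0 := by
    intro h
    rw [sub_eq_zero] at h
    subst h
    apply hK1
    rw [RatFunc.mk_eq_div, div_self]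
    simpa using hsr.1
  have hspan : WK F u v = Submodule.span F
      {q : Polynomial F | ∃ ℓ : ℕ, ℓ < (v - u).natDegree ∧ q = X ^ ℓ} := by
    simp only [WK, forall_ne_natDegree_phiK_iff huv hcase, and_comm]
  refine ⟨fun p hp => natDegree_phiK huv hcase hp, hspan, ?_⟩
  rw [hspan, span_X_pow_lt_eq_degreeLT, finrank_degreeLT]
end

section
/- Let K = u/v be shift-reduced with K ≠ 1, set α₁ = deg(u), β = deg(v − u), and τ_K = lc(v − u)/lc(u) (the quotient of leading coefficients). If β = α₁ − 1 and τ_K is not a positive integer (i.e., τ_K ≠ m·1_F for every positive natural number m), then deg(φ_K(p)) = α₁ + deg(p) − 1 for every nonzero p ∈ F[y], W_K is the F-linear span of {1, y, …, y^{α₁−2}}, and dim_F(W_K) = α₁ − 1. -/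
open Polynomial

theorem pshift_one_eq_taylor {F : Type*} [Field F] (p : F[X]) :
    pshift F 1 p = taylor 1 p := by
  simp [pshift, taylor_apply, comp, aeval_def]

theorem natDegree_taylor_sub_self_le {R : Type*} [CommRing R] (r : R) (p : R[X]) :
    (taylor r p - p).natDegree ≤ p.natDegree - 1 := by
  rw [natDegree_le_iff_coeff_eq_zero]
  intro n hn
  rcases Nat.lt_or_ge p.natDegree n with h | h
  · rw [coeff_sub, coeff_eq_zero_of_natDegree_lt h, coeff_eq_zero_of_natDegree_lt, sub_zero]
    rwa [natDegree_taylor]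
  · obtain rfl : n = p.natDegree := by omega
    rw [coeff_sub, coeff_taylor_natDegree, leadingCoeff, sub_self]

theorem coeff_taylor_sub_self {R : Type*} [CommRing R] (r : R) (p : R[X]) {d : ℕ}
    (hd : p.natDegree = d + 1) :
    (taylor r p - p).coeff d = (d + 1) * p.leadingCoeff * r := by
  have h : (hasseDeriv d p).natDegree < 2 :=
    (natDegree_hasseDeriv_le p d).trans_lt (by omega)
  rw [coeff_sub, taylor_coeff, eval_eq_sum_range' h, leadingCoeff, hd]
  simp [Finset.sum_range_succ, hasseDeriv_coeff, add_comm 1 d]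

theorem phiK_eq {F : Type*} [Field F] (u v p : F[X]) :
    phiK u v p = u * (taylor 1 p - p) - (v - u) * p := by
  rw [phiK, pshift_one_eq_taylor]
  ring

theorem natDegree_phiK_s9 {F : Type*} [Field F] {u v : F[X]} (hvu : v - u ≠ 0)
    (hdeg : u.natDegree = (v - u).natDegree + 1)
    (htau : ∀ m : ℕ, 0 < m → (v - u).leadingCoeff / u.leadingCoeff ≠ (m : F))
    {p : F[X]} (hp : p ≠ 0) :
    phiK u v p ≠ 0 ∧ (phiK u v p).natDegree = (v - u).natDegree + p.natDegree := by
  have hu : u ≠ 0 := by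
    rintro rfl
    simp at hdeg
  have hlp : p.leadingCoeff ≠ 0 := leadingCoeff_ne_zero.mpr hp
  have hlu : u.leadingCoeff ≠ 0 := leadingCoeff_ne_zero.mpr hu
  rcases Nat.eq_zero_or_pos p.natDegree with h0 | hpos
  · have hφ : phiK u v p = -((v - u) * p) := by
      rw [phiK_eq, eq_C_of_natDegree_eq_zero h0]
      simp
    rw [hφ, natDegree_neg, natDegree_mul hvu hp]
    exact ⟨neg_ne_zero.mpr (mul_ne_zero hvu hp), rfl⟩
  · obtain ⟨d, hd⟩ := Nat.exists_eq_add_of_lt hpos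
    rw [zero_add] at hd
    have hle : (taylor 1 p - p).natDegree ≤ d := by
      simpa [hd] using natDegree_taylor_sub_self_le 1 p
    have hcoeff : (phiK u v p).coeff ((v - u).natDegree + p.natDegree) ≠ 0 := by
      have hu' : (u * (taylor 1 p - p)).coeff ((v - u).natDegree + p.natDegree) =
          u.leadingCoeff * ((d + 1) * p.leadingCoeff) := by
        rw [show (v - u).natDegree + p.natDegree = u.natDegree + d by omega,
          coeff_mul_add_eq_of_natDegree_le le_rfl hle, coeff_taylor_sub_self 1 p hd, mul_one, coeff_natDegree]
      rw [phiK_eq, coeff_sub, hu', coeff_mul_degree_add_degree]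
      intro h
      refine htau (d + 1) d.succ_pos ?_
      rw [div_eq_iff hlu]
      refine mul_right_cancel₀ hlp ?_
      push_cast
      linear_combination -h
    refine ⟨fun h => hcoeff (by simp [h]), natDegree_eq_of_le_of_coeff_ne_zero ?_ hcoeff⟩
    rw [phiK_eq]
    refine (natDegree_sub_le_of_le natDegree_mul_le natDegree_mul_le).trans (max_le ?_ le_rfl)
    omega

theorem WK_eq_degreeLT {F : Type*} [Field F] {u v : F[X]} (n : ℕ)
    (h : ∀ p : F[X], p ≠ 0 → phiK u v p ≠ 0 ∧ (phiK u v p).natDegree = n + p.natDegree) :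
    WK F u v = degreeLT F n := by
  classical
  rw [WK, degreeLT_eq_span_X_pow]
  congr 1
  ext q
  simp only [Finset.coe_image, Finset.coe_range, Set.mem_image, Set.mem_Iio, Set.mem_ofPred_eq]
  constructor
  · rintro ⟨l, rfl, hl⟩
    refine ⟨l, ?_, rfl⟩
    by_contra! hnl
    obtain ⟨h0, hdeg⟩ := h (X ^ (l - n)) (pow_ne_zero _ X_ne_zero)
    refine hl _ ⟨_, rfl⟩ h0 ?_
    rw [hdeg, natDegree_X_pow]
    omega
  · rintro ⟨l, hl, rfl⟩
    refine ⟨l, rfl, ?_⟩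
    rintro _ ⟨p, rfl⟩ h0
    have hp : p ≠ 0 := by
      rintro rfl
      simp [phiK] at h0
    rw [(h p hp).2]
    omega

/-- Case β = α₁ − 1 and τ_K not a positive integer. -/
theorem stmt9 {F : Type*} [Field F] [CharZero F] (u v : Polynomial F)
    (hsr : shiftReducedPair u v) (hK1 : RatFunc.mk u v ≠ 1)
    (hcase : ((v - u).natDegree : ℤ) = (u.natDegree : ℤ) - 1)
    (htau : ∀ m : ℕ, 0 < m → (v - u).leadingCoeff / u.leadingCoeff ≠ (m : F)) :
    (∀ p : Polynomial F, p ≠ 0 →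
        (phiK u v p).natDegree = u.natDegree + p.natDegree - 1) ∧
    WK F u v = Submodule.span F
      {q : Polynomial F | ∃ j : ℕ, (j : ℤ) ≤ (u.natDegree : ℤ) - 2 ∧ q = X ^ j} ∧
    Module.finrank F (WK F u v) = u.natDegree - 1 := by
  classical
  obtain ⟨-, -, huv, -⟩ := hsr
  have hdeg : u.natDegree = (v - u).natDegree + 1 := by omega
  have hvu : v - u ≠ 0 := by
    intro h
    obtain rfl := sub_eq_zero.mp h
    have := natDegree_eq_zero_of_isUnit (isCoprime_self.mp huv)
    omega
  have hφ := fun (p : F[X]) (hp : p ≠ 0) => natDegree_phiK_s9 hvu hdeg htau hp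
  have hW := WK_eq_degreeLT _ hφ
  refine ⟨fun p hp => ?_, ?_, ?_⟩
  · rw [(hφ p hp).2]
    omega
  · rw [hW, degreeLT_eq_span_X_pow]
    congr 1
    ext q
    simp only [Finset.coe_image, Finset.coe_range, Set.mem_image, Set.mem_Iio, Set.mem_ofPred_eq]
    exact exists_congr fun j => and_congr (by omega) eq_comm
  · rw [hW, (degreeLTEquiv F _).finrank_eq, Module.finrank_fin_fun]
    omega
end

section
/- Let K = u/v be shift-reduced with K ≠ 1, let p₂ ∈ F[y], and let m be a positive natural number. Then there exists q₂ ∈ W_K such that p₂ / (∏_{j=1}^{m} σ^{-j}(u)) − q₂/v belongs to V_K. -/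
open Polynomial

theorem pshift_pshift {F : Type*} [Field F] (i j : ℤ) (p : F[X]) :
    pshift F i (pshift F j p) = pshift F (i + j) p := by
  have h : (pshift F i).comp (pshift F j) = pshift F (i + j) := by
    ext
    simp [pshift, add_assoc]
  exact DFunLike.congr_fun h p

theorem pshift_zero {F : Type*} [Field F] (p : F[X]) : pshift F 0 p = p := by
  simp [pshift]

theorem pshift_injective {F : Type*} [Field F] (i : ℤ) : Function.Injective (pshift F i) := by
  refine Function.LeftInverse.injective (g := pshift F (-i)) fun p => ?_
  rw [pshift_pshift, neg_add_cancel, pshift_zero]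

/-- The shift by one on rational functions, as a ring homomorphism. -/
noncomputable def rshiftHom (F : Type*) [Field F] : RatFunc F →+* RatFunc F :=
  RatFunc.mapRingHom (pshift F 1)
    (nonZeroDivisors_le_comap_nonZeroDivisors_of_injective _ (pshift_injective 1))

theorem rshift_one_eq {F : Type*} [Field F] (f : RatFunc F) : rshift F 1 f = rshiftHom F f := by
  rw [rshift, RatFunc.mk_eq_div, rshiftHom, RatFunc.coe_mapRingHom_eq_coe_map, RatFunc.map_apply]

theorem rshiftHom_algebraMap {F : Type*} [Field F] (p : F[X]) :
    rshiftHom F (algebraMap F[X] (RatFunc F) p) =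
      algebraMap F[X] (RatFunc F) (pshift F 1 p) := by
  have h := RatFunc.map_apply_div (pshift F 1)
    (nonZeroDivisors_le_comap_nonZeroDivisors_of_injective _ (pshift_injective 1)) p 1
  simpa [rshiftHom, RatFunc.coe_mapRingHom_eq_coe_map] using h

theorem VK_add {F : Type*} [Field F] {K f g : RatFunc F} (hf : f ∈ VK K) (hg : g ∈ VK K) :
    f + g ∈ VK K := by
  obtain ⟨r, rfl⟩ := hf
  obtain ⟨s, rfl⟩ := hg
  refine ⟨r + s, ?_⟩
  simp only [rshift_one_eq, map_add]
  ring

theorem VK_neg {F : Type*} [Field F] {K f : RatFunc F} (hf : f ∈ VK K) : -f ∈ VK K := by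
  obtain ⟨r, rfl⟩ := hf
  refine ⟨-r, ?_⟩
  simp only [rshift_one_eq, map_neg]
  ring

theorem phiK_add {F : Type*} [Field F] (u v p q : F[X]) :
    phiK u v (p + q) = phiK u v p + phiK u v q := by
  simp only [phiK, map_add]
  ring

theorem phiK_C_mul {F : Type*} [Field F] (u v p : F[X]) (c : F) :
    phiK u v (C c * p) = C c * phiK u v p := by
  have h : pshift F 1 (C c) = C c := by simp [pshift]
  simp only [phiK, map_mul, h]
  ring

/-- Every polynomial is the sum of an element of the image of `phiK u v` and one of `WK F u v`. -/
theorem exists_phiK_add_mem_WK {F : Type*} [Field F] (u v : F[X]) (p : F[X]) :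
    ∃ r, ∃ q ∈ WK F u v, p = phiK u v r + q := by
  induction hn : p.degree using WellFoundedLT.induction generalizing p with
  | ind n ih =>
    subst hn
    by_cases hp : p = 0
    · exact ⟨0, 0, zero_mem _, by simp [hp, phiK]⟩
    by_cases h : ∃ r, phiK u v r ≠ 0 ∧ p.natDegree = (phiK u v r).natDegree
    · obtain ⟨r, hr, hdeg⟩ := h
      set c := p.leadingCoeff / (phiK u v r).leadingCoeff with hc
      have hlc : (phiK u v r).leadingCoeff ≠ 0 := leadingCoeff_ne_zero.mpr hr
      have hc0 : c ≠ 0 := div_ne_zero (leadingCoeff_ne_zero.mpr hp) hlc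
      obtain ⟨s, q, hq, hs⟩ := ih _ (degree_sub_lt_left (q := C c * phiK u v r)
        (by rw [degree_C_mul hc0, degree_eq_natDegree hp, degree_eq_natDegree hr, hdeg]) hp
        (by rw [leadingCoeff_mul, leadingCoeff_C, hc, div_mul_cancel₀ _ hlc])) _ rfl
      refine ⟨s + C c * r, q, hq, ?_⟩
      rw [phiK_add, phiK_C_mul]
      linear_combination hs
    · push Not at h
      obtain ⟨s, q, hq, hs⟩ := ih _ (degree_eraseLead_lt hp) _ rfl
      refine ⟨s, q + p.leadingCoeff • X ^ p.natDegree,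
        add_mem hq (Submodule.smul_mem _ _ (Submodule.subset_span ⟨_, rfl, ?_⟩)), ?_⟩
      · rintro _ ⟨r, rfl⟩ hr
        exact h r hr
      · rw [← add_assoc, ← hs, smul_eq_C_mul, eraseLead_add_C_mul_X_pow]

theorem phiK_div_mem_VK {F : Type*} [Field F] {u v : F[X]} (hv : v ≠ 0) (r : F[X]) :
    algebraMap F[X] (RatFunc F) (phiK u v r) / algebraMap F[X] (RatFunc F) v ∈
      VK (RatFunc.mk u v) := by
  have hv' := RatFunc.algebraMap_ne_zero hv
  refine ⟨algebraMap _ _ r, ?_⟩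
  rw [rshift_one_eq, rshiftHom_algebraMap, RatFunc.mk_eq_div, phiK, map_sub, map_mul, map_mul]
  field_simp

theorem pshift_one_prod_range_succ {F : Type*} [Field F] (u : F[X]) (m : ℕ) :
    pshift F 1 (∏ j ∈ Finset.range (m + 1), pshift F (-((j + 1 : ℕ) : ℤ)) u) =
      u * ∏ j ∈ Finset.range m, pshift F (-((j + 1 : ℕ) : ℤ)) u := by
  rw [map_prod, Finset.prod_range_succ', mul_comm]
  congr 1
  · simp [pshift_pshift, pshift_zero]
  · refine Finset.prod_congr rfl fun j _ => ?_
    rw [pshift_pshift]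
    congr 2

/-- Modulo `VK`, a fraction over a product of backward shifts of `u` has a representative with
denominator `v`. -/
theorem exists_sub_div_mem_VK {F : Type*} [Field F] {u v : F[X]} (h : shiftReducedPair u v)
    (m : ℕ) (p : F[X]) :
    ∃ q : F[X], algebraMap F[X] (RatFunc F) p /
        algebraMap F[X] (RatFunc F) (∏ j ∈ Finset.range m, pshift F (-((j + 1 : ℕ) : ℤ)) u) -
      algebraMap F[X] (RatFunc F) q / algebraMap F[X] (RatFunc F) v ∈ VK (RatFunc.mk u v) := by
  obtain ⟨hu, hv, -, hco⟩ := h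
  have hu' := RatFunc.algebraMap_ne_zero hu
  have hv' := RatFunc.algebraMap_ne_zero hv
  induction m generalizing p with
  | zero =>
    refine ⟨p * v, 0, ?_⟩
    rw [rshift_one_eq, Finset.prod_range_zero, map_mul, map_one, map_zero]
    field_simp
    ring
  | succ m ih =>
    have hshift := pshift_one_prod_range_succ u m
    set D := ∏ j ∈ Finset.range m, pshift F (-((j + 1 : ℕ) : ℤ)) u
    set E := ∏ j ∈ Finset.range (m + 1), pshift F (-((j + 1 : ℕ) : ℤ)) u
    have hD0 : D ≠ 0 := Finset.prod_ne_zero_iff.mpr fun j _ =>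
      (map_ne_zero_iff _ (pshift_injective _)).mpr hu
    have hD' := RatFunc.algebraMap_ne_zero hD0
    have hcop : IsCoprime D v := IsCoprime.prod_left fun j _ => by
      simpa [pshift_pshift, pshift_zero] using
        (hco ((j + 1 : ℕ) : ℤ)).map (pshift F (-((j + 1 : ℕ) : ℤ))).toRingHom
    obtain ⟨s, t, hst⟩ := hcop
    obtain ⟨q, hq⟩ := ih (pshift F 1 p * t)
    refine ⟨q + pshift F 1 p * s, ?_⟩
    have hV : RatFunc.mk u v *
        rshift F 1 (algebraMap F[X] (RatFunc F) p / algebraMap F[X] (RatFunc F) E) -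
        algebraMap F[X] (RatFunc F) p / algebraMap F[X] (RatFunc F) E ∈ VK (RatFunc.mk u v) :=
      ⟨_, rfl⟩
    convert VK_add hq (VK_neg hV) using 1
    rw [rshift_one_eq, map_div₀, rshiftHom_algebraMap, rshiftHom_algebraMap, hshift,
      RatFunc.mk_eq_div]
    have hst' := congrArg (algebraMap F[X] (RatFunc F)) hst
    simp only [map_add, map_mul, map_one] at hst' ⊢
    have key : algebraMap F[X] (RatFunc F) u / algebraMap F[X] (RatFunc F) v *
        (algebraMap F[X] (RatFunc F) (pshift F 1 p) /
          (algebraMap F[X] (RatFunc F) u * algebraMap F[X] (RatFunc F) D)) =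
        algebraMap F[X] (RatFunc F) (pshift F 1 p) * algebraMap F[X] (RatFunc F) t /
          algebraMap F[X] (RatFunc F) D +
        algebraMap F[X] (RatFunc F) (pshift F 1 p) * algebraMap F[X] (RatFunc F) s /
          algebraMap F[X] (RatFunc F) v := by
      field_simp
      linear_combination (-algebraMap F[X] (RatFunc F) (pshift F 1 p)) * hst'
    rw [key]
    ring

/-- p₂ / ∏_{j=1}^{m} σ^{-j}(u) is congruent modulo V_K to q₂/v for some
q₂ ∈ W_K. -/
theorem stmt15 {F : Type*} [Field F] [CharZero F] (u v p₂ : Polynomial F) (m : ℕ)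
    (hsr : shiftReducedPair u v) (hK1 : RatFunc.mk u v ≠ 1) (hm : 0 < m) :
    ∃ q₂ ∈ WK F u v,
      RatFunc.mk p₂ (∏ j ∈ Finset.Icc 1 m, pshift F (-(j : ℤ)) u) - RatFunc.mk q₂ v
        ∈ VK (RatFunc.mk u v) := by
  obtain ⟨q, hq⟩ := exists_sub_div_mem_VK hsr m p₂
  obtain ⟨r, w, hw, hqw⟩ := exists_phiK_add_mem_WK u v q
  refine ⟨w, hw, ?_⟩
  have hprod : ∏ j ∈ Finset.Icc 1 m, pshift F (-(j : ℤ)) u =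
      ∏ j ∈ Finset.range m, pshift F (-((j + 1 : ℕ) : ℤ)) u := by
    rw [Finset.range_eq_Ico, Finset.prod_Ico_add' (fun j : ℕ => pshift F (-(j : ℤ)) u) 0 m 1]
    rfl
  rw [hprod, RatFunc.mk_eq_div p₂, RatFunc.mk_eq_div w]
  convert VK_add hq (phiK_div_mem_VK hsr.2.1 r) using 1
  rw [hqw, map_add]
  ring
end
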